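/- Let Γ = ⟨α, β⟩ with α, β coprime, 2 ≤ α < β, α odd and β even. Then: (i) the total number of sets Δ ⊆ ℕ with 0 ∈ Δ and Δ + Γ ⊆ Δ that are selfdual equals C((α−1)/2 + β/2, (α−1)/2); (ii) for 0 ≤ ℓ ≤ (α−1)/2, the number of such selfdual Δ whose minimal system of generators has exactly 2ℓ + 1 elements equals C((α−1)/2, ℓ) · C(β/2 − 1, ℓ); (iii) for 1 ≤ ℓ ≤ (α−1)/2, the number with exactly 2ℓ elements equals C((α−1)/2, ℓ) · C(β/2 − 1, ℓ − 1). -/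

import Mathlib

/-- The numerical semigroup `⟨α, β⟩ = {pα + qβ : p, q ∈ ℕ}`, viewed inside `ℤ`. -/
def Gamma (α β : ℕ) : Set ℤ := {x : ℤ | ∃ p q : ℕ, x = (p : ℤ) * α + (q : ℤ) * β}

/-- The dual `Δ* = {c ∈ ℤ : c + Δ ⊆ ⟨α,β⟩}` of an `⟨α,β⟩`-semimodule. -/
def dualSet (α β : ℕ) (Δ : Set ℤ) : Set ℤ := {c : ℤ | ∀ x ∈ Δ, c + x ∈ Gamma α β}

/-- A normalized `⟨α,β⟩`-semimodule: a subset of `ℕ` containing `0`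
with `Δ + Γ ⊆ Δ`. -/
def IsNormalizedSemimodule (α β : ℕ) (Δ : Set ℤ) : Prop :=
  (0 : ℤ) ∈ Δ ∧ (∀ x ∈ Δ, 0 ≤ x) ∧ ∀ x ∈ Δ, ∀ γ ∈ Gamma α β, x + γ ∈ Δ

/-- `Δ` is selfdual if `Δ*` is a shift of `Δ`. -/
def IsSelfdual (α β : ℕ) (Δ : Set ℤ) : Prop :=
  ∃ c : ℤ, dualSet α β Δ = (fun x => c + x) '' Δ

/-- `E` is the minimal system of generators of `Δ`: it generates `Δ`
(`⋃_{x∈E}(x+Γ) = Δ`) and no proper subset of it generates `Δ`. -/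
def IsMinGenSet (α β : ℕ) (Δ : Set ℤ) (E : Finset ℤ) : Prop :=
  (↑E ⊆ Δ) ∧ (⋃ x ∈ (E : Set ℤ), (fun γ => x + γ) '' Gamma α β) = Δ ∧
    ∀ F : Finset ℤ, F ⊂ E → (⋃ x ∈ (F : Set ℤ), (fun γ => x + γ) '' Gamma α β) ≠ Δ

/-! Part A: the semigroup -/
lemma gam_not_both {α β : ℕ} (hα : 0 < α) (hβ : 0 < β) (hc : Nat.Coprime α β) {x : ℤ}
    (h1 : x ∈ Gamma α β) (h2 : (α : ℤ) * β - α - β - x ∈ Gamma α β) : False := by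
  obtain ⟨p, q, h1⟩ := h1
  obtain ⟨p', q', h2⟩ := h2
  have h : α * β = (p + p' + 1) * α + (q + q' + 1) * β := by
    zify; linarith
  have d1 : β ∣ (p + p' + 1) := by
    have : β ∣ (p + p' + 1) * α := by
      have h3 : β ∣ (p + p' + 1) * α + (q + q' + 1) * β := h ▸ Dvd.intro_left α rfl
      exact (Nat.dvd_add_left (Dvd.intro_left _ rfl)).1 h3
    exact (Nat.Coprime.symm hc).dvd_of_dvd_mul_right this
  have l1 : β ≤ p + p' + 1 := Nat.le_of_dvd (by omega) d1
  have : β * α ≤ (p + p' + 1) * α := Nat.mul_le_mul_right _ l1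
  have : 0 < (q + q' + 1) * β := by positivity
  nlinarith

lemma gam_one {α β : ℕ} (hβ : 0 < β) (hc : Nat.Coprime α β) (x : ℤ) :
    x ∈ Gamma α β ∨ (α : ℤ) * β - α - β - x ∈ Gamma α β := by
  have hb : (0 : ℤ) < β := by exact_mod_cast hβ
  have hco : IsCoprime (α : ℤ) (β : ℤ) := Nat.isCoprime_iff_coprime.2 hc
  obtain ⟨u, v, huv⟩ := hco
  obtain ⟨p, hp⟩ : ∃ p, p = (x * u) % β := ⟨_, rfl⟩
  have hp0 : 0 ≤ p := hp ▸ Int.emod_nonneg _ hb.ne'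
  have hp1 : p < β := hp ▸ Int.emod_lt_of_pos _ hb
  have hd := Int.mul_ediv_add_emod (x * u) β
  rw [← hp] at hd
  obtain ⟨t, ht⟩ : ∃ t, t = (x * u) / (β : ℤ) := ⟨_, rfl⟩
  rw [← ht] at hd
  have hx : x = p * α + (x * v + t * α) * β := by
    have : x = x * (u * α + v * β) := by rw [huv]; ring
    calc x = x * (u * α + v * β) := this
      _ = (x * u) * α + x * v * β := by ring
      _ = _ := by rw [← hd]; ring
  obtain ⟨q, hq⟩ : ∃ q, q = x * v + t * α := ⟨_, rfl⟩
  rw [← hq] at hx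
  rcases le_or_gt 0 q with h | h
  · left
    refine ⟨p.toNat, q.toNat, ?_⟩
    rw [Int.toNat_of_nonneg hp0, Int.toNat_of_nonneg h]; exact hx
  · right
    refine ⟨(β - 1 - p).toNat, (-1 - q).toNat, ?_⟩
    rw [Int.toNat_of_nonneg (by omega), Int.toNat_of_nonneg (by omega), hx]; ring

lemma gam_nonneg {α β : ℕ} {x : ℤ} (h : x ∈ Gamma α β) : 0 ≤ x := by
  obtain ⟨p, q, rfl⟩ := h
  positivity

lemma gam_large {α β : ℕ} (hβ : 0 < β) (hc : Nat.Coprime α β) {x : ℤ}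
    (hx : (α : ℤ) * β ≤ x) : x ∈ Gamma α β := by
  rcases gam_one hβ hc x with h | h
  · exact h
  · have := gam_nonneg h
    have : (0 : ℤ) < β := by exact_mod_cast hβ
    have : (0 : ℤ) ≤ α := by positivity
    omega

lemma gam_closed {α β : ℕ} {T : Set ℤ} (h1 : ∀ x ∈ T, x + α ∈ T) (h2 : ∀ x ∈ T, x + β ∈ T) :
    ∀ x ∈ T, ∀ g ∈ Gamma α β, x + g ∈ T := by
  have e1 : ∀ p : ℕ, ∀ x ∈ T, x + p * α ∈ T := by
    intro p
    induction p with
    | zero => intro x hx; simpa using hx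
    | succ k ih => intro x hx; have := h1 _ (ih x hx); push_cast; convert this using 1; ring
  have e2 : ∀ p : ℕ, ∀ x ∈ T, x + p * β ∈ T := by
    intro p
    induction p with
    | zero => intro x hx; simpa using hx
    | succ k ih => intro x hx; have := h2 _ (ih x hx); push_cast; convert this using 1; ring
  rintro x hx g ⟨p, q, rfl⟩
  have := e2 q _ (e1 p x hx)
  rwa [add_assoc] at this

lemma gam_al (α β : ℕ) : (α : ℤ) ∈ Gamma α β := ⟨1, 0, by simp⟩
lemma gam_be (α β : ℕ) : (β : ℤ) ∈ Gamma α β := ⟨0, 1, by simp⟩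
lemma gam_zero (α β : ℕ) : (0 : ℤ) ∈ Gamma α β := ⟨0, 0, by simp⟩

lemma selfdual_iff {α β : ℕ} (hα : 0 < α) (hβ : 0 < β) (hc : Nat.Coprime α β) {Δ : Set ℤ}
    (hΔ : ∀ x ∈ Δ, ∀ γ ∈ Gamma α β, x + γ ∈ Δ) :
    IsSelfdual α β Δ ↔ ∃ s : ℤ, ∀ x, x ∈ Δ ↔ s - x ∉ Δ := by
  have hd : ∀ c, c ∈ dualSet α β Δ ↔ (α : ℤ) * β - α - β - c ∉ Δ := by
    intro c
    constructor
    · intro h hx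
      have h1 := h _ hx
      refine gam_not_both hα hβ hc h1 ?_
      convert gam_zero α β using 1; ring
    · intro h x hx
      rcases gam_one hβ hc (c + x) with h1 | h1
      · exact h1
      · exfalso; apply h
        have := hΔ _ hx _ h1
        convert this using 1; ring
  constructor
  · rintro ⟨c, hcc⟩
    refine ⟨(α : ℤ) * β - α - β - c, fun x => ?_⟩
    have h1 : c + x ∈ dualSet α β Δ ↔ x ∈ Δ := by
      rw [hcc]; simp
    rw [← h1, hd, ← sub_sub]
  · rintro ⟨s, hs⟩
    refine ⟨(α : ℤ) * β - α - β - s, ?_⟩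
    ext x
    rw [hd]
    simp only [Set.mem_image]
    constructor
    · intro h
      refine ⟨x - ((α : ℤ) * β - α - β - s), ?_, by ring⟩
      rw [hs]; convert h using 2; ring
    · rintro ⟨y, hy, rfl⟩
      rw [hs] at hy; convert hy using 2; ring

def gens (α β : ℕ) (Δ : Set ℤ) : Set ℤ := {x | x ∈ Δ ∧ x - α ∉ Δ ∧ x - β ∉ Δ}

lemma gens_generate {α β : ℕ} (hα : 0 < α) (hβ : 0 < β) {Δ : Set ℤ}
    (h : IsNormalizedSemimodule α β Δ) :
    (⋃ x ∈ gens α β Δ, (fun γ => x + γ) '' Gamma α β) = Δ := by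
  obtain ⟨h0, h1, h2⟩ := h
  have key : ∀ N : ℕ, ∀ x ∈ Δ, x < N → ∃ y ∈ gens α β Δ, ∃ g ∈ Gamma α β, y + g = x := by
    intro N
    induction N with
    | zero => intro x hx hN; have := h1 x hx; simp at hN; omega
    | succ N ih =>
      intro x hx hN
      push_cast at hN
      by_cases ha : x - α ∈ Δ
      · obtain ⟨y, hy, g, ⟨p, q, rfl⟩, hg⟩ := ih _ ha (by omega)
        exact ⟨y, hy, _, ⟨p + 1, q, rfl⟩, by push_cast; linarith⟩
      · by_cases hb : x - β ∈ Δ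
        · obtain ⟨y, hy, g, ⟨p, q, rfl⟩, hg⟩ := ih _ hb (by omega)
          exact ⟨y, hy, _, ⟨p, q + 1, rfl⟩, by push_cast; linarith⟩
        · exact ⟨x, ⟨hx, ha, hb⟩, 0, gam_zero _ _, by ring⟩
  ext x
  simp only [Set.mem_iUnion, Set.mem_image, exists_prop]
  constructor
  · rintro ⟨y, hy, g, hg, rfl⟩
    exact h2 _ hy.1 _ hg
  · intro hx
    exact key (x.toNat + 1) x hx (by have := h1 x hx; push_cast; omega)

lemma gens_sub {α β : ℕ} {Δ : Set ℤ}
    (h : IsNormalizedSemimodule α β Δ) {E : Set ℤ}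
    (hE : (⋃ x ∈ E, (fun γ => x + γ) '' Gamma α β) = Δ) : gens α β Δ ⊆ E := by
  intro x hx
  have hx1 := hx.1
  have hE' : ∀ y ∈ E, y ∈ Δ := by
    intro y hy
    rw [← hE]
    simp only [Set.mem_iUnion, Set.mem_image, exists_prop]
    exact ⟨y, hy, 0, gam_zero _ _, by ring⟩
  rw [← hE] at hx1
  simp only [Set.mem_iUnion, Set.mem_image, exists_prop] at hx1
  obtain ⟨y, hy, g, ⟨p, q, rfl⟩, hg⟩ := hx1
  rcases p with _ | p
  · rcases q with _ | q
    · simp at hg; rwa [← hg]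
    · exfalso; apply hx.2.2
      have := h.2.2 y (hE' y hy) _ ⟨0, q, rfl⟩
      convert this using 1; rw [← hg]; push_cast; ring
  · exfalso; apply hx.2.1
    have := h.2.2 y (hE' y hy) _ ⟨p, q, rfl⟩
    convert this using 1; rw [← hg]; push_cast; ring

lemma gens_finite {α β : ℕ} (hα : 0 < α) (hβ : 0 < β) (hc : Nat.Coprime α β) {Δ : Set ℤ}
    (h : IsNormalizedSemimodule α β Δ) : (gens α β Δ).Finite := by
  apply (Set.finite_Icc (0 : ℤ) (α * β + α)).subset
  intro x hx
  refine ⟨h.2.1 x hx.1, ?_⟩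
  by_contra hlt
  push Not at hlt
  apply hx.2.1
  have := h.2.2 0 h.1 (x - α) (gam_large hβ hc (by linarith))
  simpa using this

lemma minGen_iff {α β : ℕ} (hα : 0 < α) (hβ : 0 < β) (hc : Nat.Coprime α β) {Δ : Set ℤ}
    (h : IsNormalizedSemimodule α β Δ) (k : ℕ) :
    (∃ E : Finset ℤ, IsMinGenSet α β Δ E ∧ E.card = k) ↔ (gens α β Δ).ncard = k := by
  have hf := gens_finite hα hβ hc h
  have hG := gens_generate hα hβ h
  constructor
  · rintro ⟨E, ⟨h1, h2, h3⟩, hk⟩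
    have hs := gens_sub h h2
    by_cases he : hf.toFinset = E
    · rw [← hk, ← he, Set.ncard_eq_toFinset_card _ hf]
    · exfalso
      refine h3 hf.toFinset ?_ ?_
      · refine lt_of_le_of_ne ?_ he
        intro x hx; exact hs (by simpa using hx)
      · rw [Set.Finite.coe_toFinset]; exact hG
  · intro hk
    refine ⟨hf.toFinset, ⟨?_, ?_, ?_⟩, ?_⟩
    · rw [Set.Finite.coe_toFinset]; exact fun x hx => hx.1
    · rw [Set.Finite.coe_toFinset]; exact hG
    · intro F hF hF2
      have := gens_sub h hF2
      exact hF.2 (fun x hx => this (by simpa using hx))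
    · rw [← hk, Set.ncard_eq_toFinset_card _ hf]

/-! Part B: symmetric sets and paths -/
structure GoodP (al be : ℤ) (P : Set ℤ) : Prop where
  ex : ∀ x, ∃ y ∈ P, ∃ k : ℤ, x = y + (al + be) * k
  un : ∀ x ∈ P, ∀ y ∈ P, ∀ k : ℤ, x = y + (al + be) * k → x = y
  sy : ∀ y ∈ P, al + be - 1 - y ∈ P
  st : ∀ y ∈ P, y + al ∈ P ∨ y - be ∈ P

structure SymT (al be : ℤ) (T : Set ℤ) : Prop where
  ca : ∀ x ∈ T, x + al ∈ T
  cb : ∀ x ∈ T, x + be ∈ T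
  sy : ∀ x, x ∈ T ↔ -1 - x ∉ T

def TT (al be : ℤ) (P : Set ℤ) : Set ℤ := {x | ∃ y ∈ P, ∃ k : ℕ, x = y + (al + be) * k}

lemma GoodP.st' {al be : ℤ} {P : Set ℤ} (h : GoodP al be P) :
    ∀ y ∈ P, y - al ∈ P ∨ y + be ∈ P := by
  intro y hy
  rcases h.st _ (h.sy y hy) with h1 | h1
  · left; have := h.sy _ h1; convert this using 1; ring
  · right; have := h.sy _ h1; convert this using 1; ring

lemma GoodP.mem_iff {al be : ℤ} {P : Set ℤ} (h : GoodP al be P) (hn : 0 < al + be)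
    {y : ℤ} (hy : y ∈ P) (k : ℤ) : y + (al + be) * k ∈ TT al be P ↔ 0 ≤ k := by
  constructor
  · rintro ⟨z, hz, j, hj⟩
    have : y = z := h.un y hy z hz (j - k) (by linarith)
    subst this
    have : (al + be) * k = (al + be) * j := by linarith
    have := mul_left_cancel₀ hn.ne' this
    omega
  · intro hk
    exact ⟨y, hy, k.toNat, by rw [Int.toNat_of_nonneg hk]⟩

lemma GoodP.sub_TT {al be : ℤ} {P : Set ℤ} {y : ℤ} (hy : y ∈ P) : y ∈ TT al be P :=
  ⟨y, hy, 0, by simp⟩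

lemma GoodP.not_TT {al be : ℤ} {P : Set ℤ} (h : GoodP al be P) (hn : 0 < al + be)
    {y : ℤ} (hy : y ∈ P) : y - (al + be) ∉ TT al be P := by
  have := (h.mem_iff hn hy (-1)).not.2 (by norm_num)
  convert this using 2; ring

lemma GoodP.symT {al be : ℤ} {P : Set ℤ} (h : GoodP al be P) (hn : 0 < al + be) :
    SymT al be (TT al be P) := by
  refine ⟨?_, ?_, ?_⟩
  · rintro x ⟨y, hy, k, rfl⟩
    rcases h.st y hy with h1 | h1
    · exact ⟨_, h1, k, by ring⟩
    · exact ⟨_, h1, k + 1, by push_cast; ring⟩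
  · rintro x ⟨y, hy, k, rfl⟩
    rcases h.st' y hy with h1 | h1
    · exact ⟨_, h1, k + 1, by push_cast; ring⟩
    · exact ⟨_, h1, k, by ring⟩
  · intro x
    obtain ⟨y, hy, k, rfl⟩ := h.ex x
    rw [h.mem_iff hn hy]
    have := h.mem_iff hn (h.sy y hy) (-1 - k)
    rw [show -1 - (y + (al + be) * k) = al + be - 1 - y + (al + be) * (-1 - k) by ring, this]
    omega

lemma GoodP.gens {α β : ℕ} {P : Set ℤ} (h : GoodP α β P) (hn : (0 : ℤ) < α + β) :
    gens α β (TT α β P) = {x | x ∈ P ∧ x + α ∈ P ∧ x + β ∈ P} := by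
  have hS := h.symT hn
  ext x
  simp only [_root_.gens, Set.mem_ofPred_eq]
  constructor
  · rintro ⟨⟨y, hy, k, hk⟩, h2, h3⟩
    rcases k with _ | k
    · have : x = y := by simpa using hk
      subst this
      refine ⟨hy, ?_, ?_⟩
      · rcases h.st x hy with h4 | h4
        · exact h4
        · exact absurd (GoodP.sub_TT h4) h3
      · rcases h.st' x hy with h4 | h4
        · exact absurd (GoodP.sub_TT h4) h2
        · exact h4
    · exfalso; apply h2
      have : y + (α + β) * (k : ℤ) ∈ TT (α : ℤ) β P := ⟨y, hy, k, rfl⟩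
      have := hS.cb _ this
      convert this using 1; rw [hk]; push_cast; ring
  · rintro ⟨h1, h2, h3⟩
    refine ⟨GoodP.sub_TT h1, ?_, ?_⟩
    · have := h.not_TT hn h3
      convert this using 2; ring
    · have := h.not_TT hn h2
      convert this using 2; ring

/-- path -/
def pth (al be : ℤ) (m : ℕ) (A : Finset ℕ) (i : ℕ) : ℤ :=
  m + ∑ j ∈ Finset.range i, if j ∈ A then al else -be

lemma pth_zero (al be : ℤ) (m : ℕ) (A : Finset ℕ) : pth al be m A 0 = m := by simp [pth]

lemma pth_succ (al be : ℤ) (m : ℕ) (A : Finset ℕ) (i : ℕ) :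
    pth al be m A (i + 1) = pth al be m A i + if i ∈ A then al else -be := by
  simp [pth, Finset.sum_range_succ, add_assoc]

lemma pth_mod (al be : ℤ) (m : ℕ) (A : Finset ℕ) (i : ℕ) :
    ∃ c : ℤ, pth al be m A i = m + i * al + (al + be) * c := by
  induction i with
  | zero => exact ⟨0, by simp [pth]⟩
  | succ i ih =>
    obtain ⟨c, hc⟩ := ih
    rw [pth_succ, hc]
    split_ifs
    · exact ⟨c, by push_cast; ring⟩
    · exact ⟨c - 1, by push_cast; ring⟩

lemma pth_end (al be : ℤ) (m : ℕ) (A : Finset ℕ) (hA : A ⊆ Finset.range m) :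
    pth al be m A m = m - m * be + (al + be) * A.card := by
  have h1 : ∀ j, (if j ∈ A then al else -be) = -be + if j ∈ A then (al + be) else 0 := by
    intro j; split_ifs <;> ring
  unfold pth
  rw [Finset.sum_congr rfl (fun j _ => h1 j), Finset.sum_add_distrib, Finset.sum_ite_mem,
    Finset.inter_eq_right.2 hA]
  simp; ring

def PA (al be : ℤ) (m : ℕ) (A : Finset ℕ) : Set ℤ :=
  {x | ∃ i ≤ m, x = pth al be m A i ∨ x = al + be - 1 - pth al be m A i}

section
variable {al be : ℤ} {a b : ℕ}

lemma pth_end' (hal : al = 2 * a + 1) (hbe : be = 2 * b) {A : Finset ℕ}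
    (hA : A ⊆ Finset.range (a + b)) (hc : A.card = b) :
    al + be - 1 - pth al be (a + b) A (a + b) = pth al be (a + b) A (a + b) - be := by
  rw [pth_end _ _ _ _ hA, hc, hal, hbe]; push_cast; ring

/-- index of a residue -/
lemma idx_unique (hal : al = 2 * a + 1) (hbe : be = 2 * b) (hco : IsCoprime al (al + be))
    {i : ℤ} {k : ℤ} (h : i * al = (al + be) * k) (h1 : |i| ≤ 2 * (a + b : ℤ)) : i = 0 := by
  have hd : (al + be) ∣ i := by
    apply hco.symm.dvd_of_dvd_mul_right
    exact ⟨k, h⟩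
  by_contra h0
  have := Int.le_of_dvd (abs_pos.2 h0) ((dvd_abs _ _).2 hd)
  omega

lemma good_PA (hal : al = 2 * a + 1) (hbe : be = 2 * b) (hco : IsCoprime al (al + be))
    (hm : 0 < a + b) {A : Finset ℕ}
    (hA : A ⊆ Finset.range (a + b)) (hc : A.card = b) : GoodP al be (PA al be (a + b) A) := by
  have hn : al + be - 1 = 2 * ((a + b : ℕ) : ℤ) := by rw [hal, hbe]; push_cast; ring
  have hsy : ∀ y ∈ PA al be (a + b) A, al + be - 1 - y ∈ PA al be (a + b) A := by
    rintro y ⟨i, hi, rfl | rfl⟩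
    · exact ⟨i, hi, Or.inr rfl⟩
    · exact ⟨i, hi, Or.inl (by ring)⟩
  refine ⟨?_, ?_, hsy, ?_⟩
  · intro x
    obtain ⟨u, v, huv⟩ := hco
    -- `j` with `j * al ≡ x - m`, `|j| ≤ m`
    obtain ⟨j, hj1, hj2, k, hk⟩ : ∃ j : ℤ, -((a + b : ℕ) : ℤ) ≤ j ∧ j ≤ ((a + b : ℕ) : ℤ) ∧
        ∃ k : ℤ, x - (a + b : ℕ) = j * al + (al + be) * k := by
      have hpos : 0 < al + be := by omega
      set z : ℤ := (x - (a + b : ℕ)) * u + (a + b : ℕ) with hz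
      have e := Int.mul_ediv_add_emod z (al + be)
      have e1 := Int.emod_nonneg z hpos.ne'
      have e2 := Int.emod_lt_of_pos z hpos
      refine ⟨z % (al + be) - (a + b : ℕ), by omega, by omega,
        (x - (a + b : ℕ)) * v + z / (al + be) * al, ?_⟩
      have e3 : z % (al + be) - (a + b : ℕ) =
        (x - (a + b : ℕ)) * u - (al + be) * (z / (al + be)) := by
        rw [hz] at e ⊢; linarith
      rw [e3]
      linear_combination (-(x - ((a + b : ℕ) : ℤ))) * huv
    rcases le_total 0 j with h0 | h0
    · obtain ⟨i, rfl⟩ := Int.eq_ofNat_of_zero_le h0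
      obtain ⟨c, hc'⟩ := pth_mod al be (a + b) A i
      refine ⟨_, ⟨i, by omega, Or.inl rfl⟩, k - c, ?_⟩
      rw [hc']; linear_combination hk
    · obtain ⟨i, hi⟩ := Int.eq_ofNat_of_zero_le (a := -j) (by omega)
      obtain ⟨c, hc'⟩ := pth_mod al be (a + b) A i
      refine ⟨_, ⟨i, by omega, Or.inr rfl⟩, k + c, ?_⟩
      rw [hc', hn]
      have : j = -(i : ℤ) := by omega
      rw [this] at hk
      linear_combination hk
  · have key1 : ∀ i j : ℕ, i ≤ a + b → j ≤ a + b → ∀ k : ℤ,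
        pth al be (a + b) A i = pth al be (a + b) A j + (al + be) * k → i = j := by
      intro i j hi hj k h
      obtain ⟨c, hc1⟩ := pth_mod al be (a + b) A i
      obtain ⟨d, hd1⟩ := pth_mod al be (a + b) A j
      rw [hc1, hd1] at h
      have := idx_unique hal hbe hco (i := (i : ℤ) - j) (k := d + k - c)
        (by linear_combination h) (by rw [abs_le]; omega)
      omega
    have key2 : ∀ i j : ℕ, i ≤ a + b → j ≤ a + b → ∀ k : ℤ,
        pth al be (a + b) A i = al + be - 1 - pth al be (a + b) A j + (al + be) * k →
          i = 0 ∧ j = 0 := by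
      intro i j hi hj k h
      obtain ⟨c, hc1⟩ := pth_mod al be (a + b) A i
      obtain ⟨d, hd1⟩ := pth_mod al be (a + b) A j
      rw [hc1, hd1, hn] at h
      have := idx_unique hal hbe hco (i := (i : ℤ) + j) (k := k - d - c)
        (by linear_combination h) (by rw [abs_le]; omega)
      omega
    rintro x ⟨i, hi, rfl | rfl⟩ y ⟨j, hj, rfl | rfl⟩ k h
    · rw [key1 i j hi hj k h]
    · obtain ⟨rfl, rfl⟩ := key2 i j hi hj k h
      rw [pth_zero, hn]; ring
    · obtain ⟨rfl, rfl⟩ := key2 j i hj hi (-k) (by linear_combination -h)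
      rw [pth_zero, hn]; ring
    · rw [key1 i j hi hj (-k) (by linear_combination -h)]
  · rintro y ⟨i, hi, rfl | rfl⟩
    · rcases Nat.lt_or_ge i (a + b) with h | h
      · have := pth_succ al be (a + b) A i
        split_ifs at this
        · left; exact ⟨i + 1, h, Or.inl this.symm⟩
        · right; exact ⟨i + 1, h, Or.inl (by rw [this]; ring)⟩
      · obtain rfl : i = a + b := by omega
        right
        exact ⟨a + b, le_rfl, Or.inr (pth_end' hal hbe hA hc).symm⟩
    · rcases i with _ | i
      · have := pth_succ al be (a + b) A 0
        rw [pth_zero, hn]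
        rw [pth_zero] at this
        split_ifs at this
        · left; exact ⟨1, hm, Or.inl (by rw [this]; ring)⟩
        · right; exact ⟨1, hm, Or.inl (by rw [this]; ring)⟩
      · have := pth_succ al be (a + b) A i
        split_ifs at this
        · left; exact ⟨i, by omega, Or.inr (by rw [this]; ring)⟩
        · right; exact ⟨i, by omega, Or.inr (by rw [this]; ring)⟩

/-- every symmetric set comes from a path -/
lemma exists_A (hal : al = 2 * a + 1) (hbe : be = 2 * b) (hco : IsCoprime al (al + be))
    (hm : 0 < a + b) {T : Set ℤ} (hT : SymT al be T) :
    ∃ A ⊆ Finset.range (a + b), A.card = b ∧ T = TT al be (PA al be (a + b) A) := by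
  have hn : al + be - 1 = 2 * ((a + b : ℕ) : ℤ) := by rw [hal, hbe]; push_cast; ring
  have hpos : 0 < al + be := by omega
  have hcn : ∀ x ∈ T, ∀ k : ℕ, x + (al + be) * k ∈ T := by
    intro x hx k
    induction k with
    | zero => simpa using hx
    | succ k ih =>
      have := hT.cb _ (hT.ca _ ih)
      convert this using 1; push_cast; ring
  set D : Set ℤ := {x | x ∈ T ∧ x - (al + be) ∉ T} with hD
  have Dun : ∀ x ∈ D, ∀ y ∈ T, ∀ k : ℤ, y = x + (al + be) * k → 0 ≤ k := by
    intro x hx y hy k h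
    by_contra hk
    apply hx.2
    have := hcn y hy (-1 - k).toNat
    rw [Int.toNat_of_nonneg (by omega), h] at this
    convert this using 1; ring
  have Dst : ∀ x ∈ D, x + al ∈ D ∨ x - be ∈ D := by
    intro x hx
    by_cases h : x - be ∈ T
    · right; refine ⟨h, fun h2 => hx.2 ?_⟩
      have := hT.cb _ h2
      convert this using 1; ring
    · left; refine ⟨hT.ca _ hx.1, ?_⟩
      convert h using 2; ring
  have Dsy : ∀ x ∈ D, al + be - 1 - x ∈ D := by
    intro x hx
    constructor
    · rw [hT.sy]; convert hx.2 using 2; ring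
    · have := hx.1
      rw [hT.sy] at this; convert this using 2; ring
  have Dm : ((a + b : ℕ) : ℤ) ∈ D := by
    have hS := hT.sy ((a + b : ℕ) : ℤ)
    have e : ((a + b : ℕ) : ℤ) - (al + be) = -1 - ((a + b : ℕ) : ℤ) := by linarith
    have h1 : ((a + b : ℕ) : ℤ) ∈ T := by
      by_contra h
      have h2 : -1 - ((a + b : ℕ) : ℤ) ∈ T := by
        by_contra h3; exact h (hS.2 h3)
      apply h
      have := hT.cb _ (hT.ca _ h2)
      convert this using 1; linarith
    exact ⟨h1, by rw [e]; exact hS.1 h1⟩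
  have hex : ∀ i : ℕ, ∃ A ⊆ Finset.range i, ∀ j ≤ i, pth al be (a + b) A j ∈ D := by
    intro i
    induction i with
    | zero =>
      refine ⟨∅, by simp, fun j hj => ?_⟩
      obtain rfl : j = 0 := by omega
      rw [pth_zero]; exact Dm
    | succ i ih =>
      obtain ⟨A, hA, h⟩ := ih
      have hiA : i ∉ A := fun h => by simpa using hA h
      rcases Dst _ (h i le_rfl) with h1 | h1
      · have hcg : ∀ j ≤ i, pth al be (a + b) (insert i A) j = pth al be (a + b) A j := by
          intro j hj
          unfold pth
          congr 1
          apply Finset.sum_congr rfl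
          intro l hl
          rw [Finset.mem_range] at hl
          have : l ≠ i := by omega
          simp [this]
        refine ⟨insert i A, ?_, fun j hj => ?_⟩
        · rw [Finset.range_add_one]; exact Finset.insert_subset_insert _ hA
        · rcases Nat.lt_or_ge j (i + 1) with hlt | hge
          · rw [hcg j (by omega)]; exact h j (by omega)
          · obtain rfl : j = i + 1 := by omega
            rw [pth_succ, hcg i le_rfl]; simpa using h1
      · refine ⟨A, hA.trans (by simp), fun j hj => ?_⟩
        rcases Nat.lt_or_ge j (i + 1) with hlt | hge
        · exact h j (by omega)
        · obtain rfl : j = i + 1 := by omega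
          rw [pth_succ]; simpa [hiA, ← sub_eq_add_neg] using h1
  obtain ⟨A, hA, h⟩ := hex (a + b)
  have hcard : A.card = b := by
    have h1 := h (a + b) le_rfl
    have h2 := Dsy _ h1
    obtain ⟨c, hc⟩ := pth_mod al be (a + b) A (a + b)
    obtain ⟨q, hq⟩ : ∃ q, q = pth al be (a + b) A (a + b) := ⟨_, rfl⟩
    rw [← hq] at h1 h2 hc
    have hDD : ∀ x ∈ D, ∀ y ∈ D, ∀ k : ℤ, y = x + (al + be) * k → x = y := by
      intro x hx y hy k hk
      have k1 := Dun x hx y hy.1 k hk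
      have k2 := Dun y hy x hx.1 (-k) (by linear_combination -hk)
      have : k = 0 := by omega
      rw [hk, this]; ring
    have hrel : al + be - 1 - q = q + al + (al + be) * (-al - 2 * c) := by
      rw [hc, hn]
      linear_combination al * hn
    have h3 : q - be = al + be - 1 - q := by
      rcases Dst q h1 with h3 | h3
      · have := hDD _ h3 _ h2 _ hrel
        omega
      · exact hDD _ h3 _ h2 (-al - 2 * c + 1) (by rw [hrel]; ring)
    rw [hq, pth_end _ _ _ _ hA] at h3
    have h4 : (al + be) * ((A.card : ℤ) - b) = 0 := by
      have h5 : ((a + b : ℕ) : ℤ) = a + b := by push_cast; ring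
      rw [h5] at h3
      rw [hal, hbe] at h3 ⊢
      linarith
    rcases mul_eq_zero.1 h4 with h5 | h5 <;> omega
  refine ⟨A, hA, hcard, ?_⟩
  have hG := good_PA hal hbe hco hm hA hcard
  have hPD : ∀ y ∈ PA al be (a + b) A, y ∈ D := by
    rintro y ⟨i, hi, rfl | rfl⟩
    · exact h i hi
    · exact Dsy _ (h i hi)
  ext x
  constructor
  · intro hx
    obtain ⟨y, hy, k, hk⟩ := hG.ex x
    have := Dun y (hPD y hy) x hx k hk
    exact ⟨y, hy, k.toNat, by rw [Int.toNat_of_nonneg this]; exact hk⟩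
  · rintro ⟨y, hy, k, rfl⟩
    exact hcn _ (hPD y hy).1 k

lemma inj_A (hal : al = 2 * a + 1) (hbe : be = 2 * b) (hco : IsCoprime al (al + be))
    (hm : 0 < a + b) {A B : Finset ℕ}
    (hA : A ⊆ Finset.range (a + b)) (hcA : A.card = b)
    (hB : B ⊆ Finset.range (a + b)) (hcB : B.card = b)
    (h : TT al be (PA al be (a + b) A) = TT al be (PA al be (a + b) B)) : A = B := by
  have hn : al + be - 1 = 2 * ((a + b : ℕ) : ℤ) := by rw [hal, hbe]; push_cast; ring
  have hpos : 0 < al + be := by omega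
  have gA := good_PA hal hbe hco hm hA hcA
  have gB := good_PA hal hbe hco hm hB hcB
  have key : ∀ i ≤ a + b, pth al be (a + b) A i = pth al be (a + b) B i := by
    intro i hi
    obtain ⟨c, hc⟩ := pth_mod al be (a + b) A i
    obtain ⟨d, hd⟩ := pth_mod al be (a + b) B i
    have mA : pth al be (a + b) A i ∈ PA al be (a + b) A := ⟨i, hi, Or.inl rfl⟩
    have mB : pth al be (a + b) B i ∈ PA al be (a + b) B := ⟨i, hi, Or.inl rfl⟩
    have e1 : pth al be (a + b) A i = pth al be (a + b) B i + (al + be) * (c - d) := by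
      rw [hc, hd]; ring
    have e2 : pth al be (a + b) B i = pth al be (a + b) A i + (al + be) * (d - c) := by
      rw [hc, hd]; ring
    have h1 := (gB.mem_iff hpos mB (c - d)).1 (by rw [← e1, ← h]; exact GoodP.sub_TT mA)
    have h2 := (gA.mem_iff hpos mA (d - c)).1 (by rw [← e2, h]; exact GoodP.sub_TT mB)
    have : c = d := by omega
    rw [hc, hd, this]
  ext i
  rcases Nat.lt_or_ge i (a + b) with hi | hi
  · have h1 := key i (by omega)
    have h2 := key (i + 1) (by omega)
    rw [pth_succ, pth_succ, h1] at h2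
    by_cases ha : i ∈ A <;> by_cases hb : i ∈ B <;> simp [ha, hb] at h2 ⊢ <;> omega
  · have h1 : i ∉ A := fun hh => by have := hA hh; simp at this; omega
    have h2 : i ∉ B := fun hh => by have := hB hh; simp at this; omega
    simp [h1, h2]
end

/-! Part C: counting words by number of changes -/
def chg (m : ℕ) (A : Finset ℕ) : ℕ :=
  ((Finset.range m).filter (fun i => ¬ (i ∈ A ↔ i + 1 ∈ A))).card

def zz0 (m b k : ℕ) : ℕ :=
  ∑ A ∈ (Finset.range m).powerset, if A.card = b ∧ chg m A = k then 1 else 0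

def zz1 (m b k : ℕ) : ℕ :=
  ∑ A ∈ (Finset.range m).powerset, if A.card = b ∧ chg m (insert m A) = k then 1 else 0

def ff (a b k : ℕ) : ℕ :=
  match b, k with
  | 0, 0 => 1
  | 0, _ + 1 => 0
  | _ + 1, 0 => 0
  | b + 1, k + 1 => Nat.choose a ((k + 1) / 2) * Nat.choose b (k / 2)

lemma chg_succ (m : ℕ) (A : Finset ℕ) :
    chg (m + 1) A = chg m A + if (m ∈ A ↔ m + 1 ∈ A) then 0 else 1 := by
  unfold chg
  rw [Finset.range_add_one, Finset.filter_insert]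
  split_ifs with h h2 h2
  · simp
  · rw [Finset.card_insert_of_notMem (by simp)]

lemma chg_congr (m : ℕ) (A B : Finset ℕ) (h : ∀ i ≤ m, i ∈ A ↔ i ∈ B) : chg m A = chg m B := by
  unfold chg
  congr 1
  apply Finset.filter_congr
  intro i hi
  rw [Finset.mem_range] at hi
  rw [h i (by omega), h (i + 1) (by omega)]

lemma zz0_succ (m b k : ℕ) : zz0 (m + 1) b k = zz0 m b k +
    (match b, k with | b + 1, k + 1 => zz1 m b k | _, _ => 0) := by
  unfold zz0
  rw [Finset.range_add_one, Finset.sum_powerset_insert (by simp)]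
  congr 1
  · apply Finset.sum_congr rfl
    intro A hA
    have hA' : ∀ i ∈ A, i < m := fun i hi => by simpa using Finset.mem_powerset.1 hA hi
    have h1 : m ∉ A := fun h => by have := hA' _ h; omega
    have h2 : m + 1 ∉ A := fun h => by have := hA' _ h; omega
    rw [chg_succ]; simp [h1, h2]
  · have key : ∀ A ∈ (Finset.range m).powerset, (insert m A).card = A.card + 1 ∧
        chg (m + 1) (insert m A) = chg m (insert m A) + 1 := by
      intro A hA
      have hA' : ∀ i ∈ A, i < m := fun i hi => by simpa using Finset.mem_powerset.1 hA hi
      have h1 : m ∉ A := fun h => by have := hA' _ h; omega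
      have h2 : m + 1 ∉ A := fun h => by have := hA' _ h; omega
      rw [chg_succ, Finset.card_insert_of_notMem h1]; simp [h2]
    rw [Finset.sum_congr rfl (fun A hA => by rw [(key A hA).1, (key A hA).2])]
    rcases b with _ | b
    · simp
    · rcases k with _ | k
      · simp
      · simp [zz1]

lemma zz1_succ (m b k : ℕ) : zz1 (m + 1) b k =
    (match k with | k + 1 => zz0 m b k | _ => 0) +
    (match b with | b + 1 => zz1 m b k | _ => 0) := by
  unfold zz1
  rw [Finset.range_add_one, Finset.sum_powerset_insert (by simp)]
  congr 1
  · have key : ∀ A ∈ (Finset.range m).powerset,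
        chg (m + 1) (insert (m + 1) A) = chg m A + 1 := by
      intro A hA
      have hA' : ∀ i ∈ A, i < m := fun i hi => by simpa using Finset.mem_powerset.1 hA hi
      have h1 : m ∉ A := fun h => by have := hA' _ h; omega
      rw [chg_succ, chg_congr m (insert (m + 1) A) A]
      · simp [h1]
      · intro i hi; simp; omega
    rw [Finset.sum_congr rfl (fun A hA => by rw [key A hA])]
    rcases k with _ | k
    · simp
    · simp [zz0]
  · have key : ∀ A ∈ (Finset.range m).powerset, (insert m A).card = A.card + 1 ∧
        chg (m + 1) (insert (m + 1) (insert m A)) = chg m (insert m A) := by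
      intro A hA
      have hA' : ∀ i ∈ A, i < m := fun i hi => by simpa using Finset.mem_powerset.1 hA hi
      have h1 : m ∉ A := fun h => by have := hA' _ h; omega
      rw [chg_succ, Finset.card_insert_of_notMem h1,
        chg_congr m (insert (m + 1) (insert m A)) (insert m A)]
      · simp
      · intro i hi; simp; omega
    rw [Finset.sum_congr rfl (fun A hA => by rw [(key A hA).1, (key A hA).2])]
    rcases b with _ | b
    · simp
    · simp

lemma zz_gt (m : ℕ) : ∀ b k, m < b → zz0 m b k = 0 ∧ zz1 m b k = 0 := by
  intro b k h
  have : ∀ A ∈ (Finset.range m).powerset, A.card ≠ b := by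
    intro A hA
    have := Finset.card_le_card (Finset.mem_powerset.1 hA)
    simp at this; omega
  constructor
  · apply Finset.sum_eq_zero; intro A hA; simp [this A hA]
  · apply Finset.sum_eq_zero; intro A hA; simp [this A hA]

lemma ff_rec1 (a b k : ℕ) : ff (a + 1) (b + 1) (k + 1) = ff a (b + 1) (k + 1) + ff b (a + 1) k := by
  rcases k with _ | k
  · simp [ff]
  · simp only [ff]
    have : (k + 1 + 1) / 2 = k / 2 + 1 := by omega
    rw [this, Nat.choose_succ_succ]; ring

lemma zz_eq : ∀ m a b k, a + b = m → zz0 m b k = ff a b k ∧ zz1 m b k = ff b a k := by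
  intro m
  induction m with
  | zero =>
    intro a b k h
    obtain ⟨rfl, rfl⟩ : a = 0 ∧ b = 0 := by omega
    rcases k with _ | k <;> simp [zz0, zz1, ff, chg]
  | succ m ih =>
    intro a b k h
    rw [zz0_succ, zz1_succ]
    rcases a with _ | a
    · obtain rfl : b = m + 1 := by omega
      have h1 := fun k => (zz_gt m (m + 1) k (by omega)).1
      have h2 := fun k => (ih 0 m k (by omega)).2
      rcases k with _ | k
      · simp [h1, h2, ff]
      · simp only [h1, h2, ff]
        rcases k with _ | k
        · simp
        · simp
          left; exact Nat.choose_eq_zero_of_lt (by omega)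
    · have h1 := fun k => (ih a b k (by omega)).1
      rcases b with _ | b
      · simp only [h1]
        obtain rfl : a = m := by omega
        rcases k with _ | k
        · simp [ff]
        · rcases k with _ | k
          · simp [ff]
          · simp [ff]
            left; exact Nat.choose_eq_zero_of_lt (by omega)
      · have h2 := fun k => (ih (a + 1) b k (by omega)).2
        rcases k with _ | k
        · simp [h1, h2, ff]
        · simp only [h1, h2]
          exact ⟨(ff_rec1 a b k).symm, by rw [ff_rec1 b a k, add_comm]⟩

lemma count_chg (a b k : ℕ) :
    (((Finset.range (a + b)).powersetCard b).filter (fun A => chg (a + b) A = k)).card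
      = ff a b k := by
  rw [← (zz_eq (a + b) a b k rfl).1, zz0, ← Finset.card_filter]
  congr 1
  ext A
  simp only [Finset.mem_filter, Finset.mem_powersetCard, Finset.mem_powerset]
  tauto

/-! Part D: counting generators and the main bijection -/
section
variable {al be : ℤ} {a b : ℕ}

lemma GoodP.al_iff {P : Set ℤ} (h : GoodP al be P) (hn : 0 < al + be) {x : ℤ} (hx : x ∈ P) :
    x - be ∈ P ↔ x + al ∉ P := by
  constructor
  · intro h1 h2
    have := h.un _ h2 _ h1 1 (by ring)
    omega
  · intro h1
    exact (h.st x hx).resolve_left h1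

lemma GoodP.be_iff {P : Set ℤ} (h : GoodP al be P) (hn : 0 < al + be) {x : ℤ} (hx : x ∈ P) :
    x - al ∈ P ↔ x + be ∉ P := by
  constructor
  · intro h1 h2
    have := h.un _ h2 _ h1 1 (by ring)
    omega
  · intro h1
    exact (h.st' x hx).resolve_right h1

lemma GoodP.sy_iff {P : Set ℤ} (h : GoodP al be P) (x : ℤ) :
    al + be - 1 - x ∈ P ↔ x ∈ P := by
  constructor
  · intro h1
    have := h.sy _ h1
    convert this using 1; ring
  · exact h.sy x

lemma pth_inj1 (hal : al = 2 * a + 1) (hbe : be = 2 * b) (hco : IsCoprime al (al + be))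
    {A : Finset ℕ} {i j : ℕ} (hi : i ≤ a + b) (hj : j ≤ a + b)
    (h : pth al be (a + b) A i = pth al be (a + b) A j) : i = j := by
  obtain ⟨c, hc1⟩ := pth_mod al be (a + b) A i
  obtain ⟨d, hd1⟩ := pth_mod al be (a + b) A j
  rw [hc1, hd1] at h
  have := idx_unique hal hbe hco (i := (i : ℤ) - j) (k := d - c)
    (by linear_combination h) (by rw [abs_le]; omega)
  omega

lemma pth_inj2 (hal : al = 2 * a + 1) (hbe : be = 2 * b) (hco : IsCoprime al (al + be))
    {A : Finset ℕ} {i j : ℕ} (hi : i ≤ a + b) (hj : j ≤ a + b)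
    (h : pth al be (a + b) A i = al + be - 1 - pth al be (a + b) A j) : i = 0 := by
  have hn : al + be - 1 = 2 * ((a + b : ℕ) : ℤ) := by rw [hal, hbe]; push_cast; ring
  obtain ⟨c, hc1⟩ := pth_mod al be (a + b) A i
  obtain ⟨d, hd1⟩ := pth_mod al be (a + b) A j
  rw [hc1, hd1, hn] at h
  have := idx_unique hal hbe hco (i := (i : ℤ) + j) (k := - d - c)
    (by linear_combination h) (by rw [abs_le]; omega)
  omega

lemma valley_card (hal : al = 2 * a + 1) (hbe : be = 2 * b) (hco : IsCoprime al (al + be))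
    (hm : 0 < a + b) {A : Finset ℕ}
    (hA : A ⊆ Finset.range (a + b)) (hc : A.card = b) :
    {x | x ∈ PA al be (a + b) A ∧ x + al ∈ PA al be (a + b) A ∧
      x + be ∈ PA al be (a + b) A}.ncard = chg (a + b) A := by
  have hn : al + be - 1 = 2 * ((a + b : ℕ) : ℤ) := by rw [hal, hbe]; push_cast; ring
  have hpos : 0 < al + be := by omega
  have G := good_PA hal hbe hco hm hA hc
  obtain ⟨P, hP⟩ : ∃ P, P = PA al be (a + b) A := ⟨_, rfl⟩
  rw [← hP] at G ⊢
  obtain ⟨p, hp⟩ : ∃ p, p = pth al be (a + b) A := ⟨_, rfl⟩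
  have hs : ∀ i, p (i + 1) = p i + if i ∈ A then al else -be := by
    intro i; rw [hp]; exact pth_succ _ _ _ _ _
  have hend : al + be - 1 - p (a + b) = p (a + b) - be := by
    rw [hp]; exact pth_end' hal hbe hA hc
  have hmA : ∀ i ∈ A, i < a + b := fun i hi => by simpa using hA hi
  have memp : ∀ i ≤ a + b, p i ∈ P := by
    intro i hi; rw [hP, hp]; exact ⟨i, hi, Or.inl rfl⟩
  have up : ∀ i ≤ a + b, (p i + al ∈ P ↔ i ∈ A) := by
    intro i hi
    by_cases h : i ∈ A
    · have h1 := hs i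
      rw [if_pos h] at h1
      rw [← h1]
      simp only [h, iff_true]
      exact memp _ (hmA i h)
    · simp only [h, iff_false]
      rw [← G.al_iff hpos (memp i hi)]
      rcases Nat.lt_or_ge i (a + b) with h2 | h2
      · have h1 := hs i
        rw [if_neg h, ← sub_eq_add_neg] at h1
        rw [← h1]; exact memp _ h2
      · obtain rfl : i = a + b := by omega
        rw [← hend, G.sy_iff]; exact memp _ le_rfl
  have dn : ∀ i, i + 1 ≤ a + b → (p (i + 1) + be ∈ P ↔ i ∉ A) := by
    intro i hi
    have h1 := hs i
    by_cases h : i ∈ A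
    · rw [if_pos h] at h1
      simp only [h, not_true_eq_false, iff_false]
      rw [← G.be_iff hpos (memp _ hi), h1]
      have := memp i (by omega)
      convert this using 1; ring
    · rw [if_neg h] at h1
      simp only [h, not_false_eq_true, iff_true]
      rw [h1]
      have := memp i (by omega)
      convert this using 1; ring
  have up' : ∀ i, i + 1 ≤ a + b → (al + be - 1 - p (i + 1) + al ∈ P ↔ i ∈ A) := by
    intro i hi
    rw [show al + be - 1 - p (i + 1) + al = al + be - 1 - (p (i + 1) - al) by ring, G.sy_iff,
      G.be_iff hpos (memp _ hi), dn i hi, not_not]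
  have dn' : ∀ i, i ≤ a + b → (al + be - 1 - p i + be ∈ P ↔ i ∉ A) := by
    intro i hi
    rw [show al + be - 1 - p i + be = al + be - 1 - (p i - be) by ring, G.sy_iff,
      G.al_iff hpos (memp _ hi), up i hi]
  have p0 : al + be - 1 - p 0 = p 0 := by
    rw [hp, pth_zero, hn]; ring
  let g : ℕ → ℤ := fun i => if i + 1 ∈ A then p (i + 1) else al + be - 1 - p (i + 1)
  have himg : {x | x ∈ P ∧ x + al ∈ P ∧ x + be ∈ P} =
      g '' ((Finset.range (a + b)).filter (fun i => ¬ (i ∈ A ↔ i + 1 ∈ A)) : Finset ℕ) := by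
    ext x
    simp only [Set.mem_ofPred_eq, Set.mem_image, Finset.mem_coe, Finset.mem_filter,
      Finset.mem_range]
    constructor
    · rintro ⟨h1, h2, h3⟩
      have h1' := h1
      rw [hP] at h1'
      obtain ⟨i, hi, hx⟩ := h1'
      rw [← hp] at hx
      rcases i with _ | i
      · exfalso
        have hx' : x = p 0 := by rcases hx with hx | hx <;> omega
        rw [hx'] at h2 h3
        rw [up 0 hi] at h2
        rw [← p0, dn' 0 hi] at h3
        exact h3 h2
      · rcases hx with rfl | rfl
        · rw [up _ hi] at h2
          rw [dn _ hi] at h3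
          exact ⟨i, ⟨by omega, by tauto⟩, by simp [g, h2]⟩
        · rw [up' _ hi] at h2
          rw [dn' _ hi] at h3
          exact ⟨i, ⟨by omega, by tauto⟩, by simp [g, h3]⟩
    · rintro ⟨i, ⟨hi, h⟩, rfl⟩
      by_cases h1 : i + 1 ∈ A
      · simp only [g, h1, if_true]
        refine ⟨memp _ hi, (up _ hi).2 h1, (dn _ hi).2 (by tauto)⟩
      · simp only [g, h1, if_false]
        refine ⟨G.sy _ (memp _ hi), (up' _ hi).2 (by tauto), (dn' _ hi).2 h1⟩
  rw [himg, Set.ncard_image_of_injOn, Set.ncard_coe_finset]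
  · rfl
  · intro i hi j hj hij
    simp only [Finset.mem_coe, Finset.mem_filter, Finset.mem_range] at hi hj
    simp only [g] at hij
    rw [hp] at hij
    have i1 : i + 1 ≤ a + b := hi.1
    have j1 : j + 1 ≤ a + b := hj.1
    split_ifs at hij
    · have := pth_inj1 hal hbe hco i1 j1 hij; omega
    · have := pth_inj2 hal hbe hco i1 j1 hij; omega
    · have := pth_inj2 hal hbe hco j1 i1 hij.symm; omega
    · have := pth_inj1 (A := A) hal hbe hco i1 j1 (by omega); omega
end

def NT (T : Set ℤ) : Set ℤ := {x | ∃ μ ∈ T, (∀ y ∈ T, μ ≤ y) ∧ x + μ ∈ T}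

lemma NT_eq {T : Set ℤ} {μ : ℤ} (h1 : μ ∈ T) (h2 : ∀ y ∈ T, μ ≤ y) : NT T = {x | x + μ ∈ T} := by
  ext x
  constructor
  · rintro ⟨ν, h3, h4, h5⟩
    have : ν = μ := le_antisymm (h4 _ h1) (h2 _ h3)
    rwa [this] at h5
  · intro h
    exact ⟨μ, h1, h2, h⟩

lemma SymT.exists_min {α β : ℕ} (hβ : 0 < β) (hc : Nat.Coprime α β) {T : Set ℤ}
    (hT : SymT α β T) : ∃ μ ∈ T, ∀ y ∈ T, μ ≤ y := by
  have hcl := gam_closed hT.ca hT.cb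
  have h0 := hT.sy 0
  have hne : ∃ x, x ∈ T := by
    by_contra h
    push Not at h
    exact h 0 (h0.2 (h _))
  have hb : ∀ y ∈ T, -1 - (α : ℤ) * β ≤ y := by
    intro y hy
    by_contra hlt
    push Not at hlt
    have e1 := hcl y hy (0 - y) (gam_large hβ hc (by linarith))
    have e2 := hcl y hy (-1 - y) (gam_large hβ hc (by linarith))
    rw [show y + (0 - y) = 0 by ring] at e1
    rw [show y + (-1 - y) = -1 - 0 by ring] at e2
    exact h0.1 e1 e2
  obtain ⟨μ, h1, h2⟩ := Int.exists_least_of_bdd ⟨_, hb⟩ hne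
  exact ⟨μ, h1, h2⟩

lemma NT_inj {α β : ℕ} (hβ : 0 < β) (hc : Nat.Coprime α β) {T T' : Set ℤ}
    (hT : SymT α β T) (hT' : SymT α β T') (h : NT T = NT T') : T = T' := by
  obtain ⟨μ, h1, h2⟩ := hT.exists_min hβ hc
  obtain ⟨ν, h3, h4⟩ := hT'.exists_min hβ hc
  rw [NT_eq h1 h2, NT_eq h3 h4] at h
  have hx : ∀ x, x ∈ T ↔ x - μ + ν ∈ T' := by
    intro x
    have : x - μ ∈ {x | x + μ ∈ T} ↔ x - μ ∈ {x | x + ν ∈ T'} := by rw [h]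
    simpa using this
  have hx2 : ∀ x, x ∈ T' ↔ x + 2 * (ν - μ) ∈ T' := by
    intro x
    have e1 := hx (x + ν - μ)
    have e2 := hx (-1 - (x + ν - μ))
    have e3 := hT.sy (x + ν - μ)
    have e4 := hT'.sy x
    rw [show x + ν - μ - μ + ν = x + 2 * (ν - μ) by ring] at e1
    rw [show -1 - (x + ν - μ) - μ + ν = -1 - x by ring] at e2
    tauto
  have hle := h4 _ ((hx2 ν).1 h3)
  have hle2 := h4 (ν - 2 * (ν - μ)) ((hx2 _).2 (by convert h3 using 1; ring))
  have : μ = ν := by omega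
  subst this
  ext x
  rw [hx x]; simp

lemma main_count {α β a b : ℕ} (hal : α = 2 * a + 1) (hbe : β = 2 * b) (hb : 0 < b)
    (hc : Nat.Coprime α β) (R : ℕ → Prop) [DecidablePred R] :
    {Δ : Set ℤ | IsNormalizedSemimodule α β Δ ∧ IsSelfdual α β Δ ∧ R (gens α β Δ).ncard}.ncard =
      (((Finset.range (a + b)).powersetCard b).filter (fun A => R (chg (a + b) A))).card := by
  have hα : 0 < α := by omega
  have hβ : 0 < β := by omega
  have hal' : (α : ℤ) = 2 * a + 1 := by exact_mod_cast hal
  have hbe' : (β : ℤ) = 2 * b := by exact_mod_cast hbe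
  have hm : 0 < a + b := by omega
  have hco : IsCoprime (α : ℤ) (α + β) := by
    have : IsCoprime (α : ℤ) β := Nat.isCoprime_iff_coprime.2 hc
    simpa [add_comm] using this.add_mul_left_right 1
  have hn : (0 : ℤ) < α + β := by omega
  have hgens : ∀ A ⊆ Finset.range (a + b), A.card = b →
      (gens α β (NT (TT α β (PA α β (a + b) A)))).ncard = chg (a + b) A := by
    intro A hA hcA
    have G := good_PA hal' hbe' hco hm hA hcA
    obtain ⟨μ, h1, h2⟩ := (G.symT hn).exists_min hβ hc
    rw [← valley_card hal' hbe' hco hm hA hcA, ← G.gens hn, NT_eq h1 h2]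
    rw [← Set.ncard_image_of_injective (gens α β {x | x + μ ∈ TT α β (PA α β (a + b) A)})
      (add_left_injective μ)]
    congr 1
    ext x
    simp only [gens, Set.mem_ofPred_eq, Set.mem_image]
    constructor
    · rintro ⟨y, ⟨e1, e2, e3⟩, rfl⟩
      refine ⟨e1, ?_, ?_⟩
      · convert e2 using 2; ring
      · convert e3 using 2; ring
    · rintro ⟨e1, e2, e3⟩
      refine ⟨x - μ, ⟨?_, ?_, ?_⟩, by ring⟩
      · convert e1 using 1; ring
      · convert e2 using 2; ring
      · convert e3 using 2; ring
  have himg : {Δ : Set ℤ | IsNormalizedSemimodule α β Δ ∧ IsSelfdual α β Δ ∧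
      R (gens α β Δ).ncard} = (fun A => NT (TT α β (PA α β (a + b) A))) ''
      (((Finset.range (a + b)).powersetCard b).filter (fun A => R (chg (a + b) A)) :
        Finset (Finset ℕ)) := by
    ext Δ
    simp only [Set.mem_ofPred_eq, Set.mem_image, Finset.mem_coe, Finset.mem_filter,
      Finset.mem_powersetCard]
    constructor
    · rintro ⟨h1, h2, h3⟩
      rw [selfdual_iff hα hβ hc h1.2.2] at h2
      obtain ⟨s, hs⟩ := h2
      rcases Int.even_or_odd' s with ⟨t, rfl | rfl⟩
      · exfalso
        have := hs t
        rw [show 2 * t - t = t by ring] at this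
        tauto
      · have hT : SymT (α : ℤ) β {x | x + (t + 1) ∈ Δ} := by
          refine ⟨?_, ?_, ?_⟩
          · intro x hx
            have := h1.2.2 _ hx _ (gam_al α β)
            simp only [Set.mem_ofPred_eq]
            convert this using 1; ring
          · intro x hx
            have := h1.2.2 _ hx _ (gam_be α β)
            simp only [Set.mem_ofPred_eq]
            convert this using 1; ring
          · intro x
            simp only [Set.mem_ofPred_eq]
            rw [hs]
            rw [show 2 * t + 1 - (x + (t + 1)) = -1 - x + (t + 1) by ring]
        obtain ⟨A, hA, hcA, hTA⟩ := exists_A hal' hbe' hco hm hT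
        have hN : NT (TT α β (PA α β (a + b) A)) = Δ := by
          rw [← hTA, NT_eq (μ := -(t + 1))]
          · ext x
            simp only [Set.mem_ofPred_eq]
            rw [show x + -(t + 1) + (t + 1) = x by ring]
          · simpa using h1.1
          · intro y hy
            have := h1.2.1 _ hy
            omega
        refine ⟨A, ⟨⟨hA, hcA⟩, ?_⟩, hN⟩
        rw [← hgens A hA hcA, hN]; exact h3
    · rintro ⟨A, ⟨⟨hA, hcA⟩, hR⟩, rfl⟩
      have G := good_PA hal' hbe' hco hm hA hcA
      have hS := G.symT hn
      obtain ⟨μ, h1, h2⟩ := hS.exists_min hβ hc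
      have hcl := gam_closed hS.ca hS.cb
      have hN := NT_eq h1 h2
      have hcl' : ∀ x ∈ NT (TT α β (PA α β (a + b) A)), ∀ γ ∈ Gamma α β,
          x + γ ∈ NT (TT α β (PA α β (a + b) A)) := by
        rw [hN]
        intro x hx g hg
        have := hcl _ hx g hg
        simp only [Set.mem_ofPred_eq]
        convert this using 1; ring
      refine ⟨⟨?_, ?_, hcl'⟩, ?_, ?_⟩
      · rw [hN]; simpa using h1
      · rw [hN]; intro x hx; have := h2 _ hx; omega
      · rw [selfdual_iff hα hβ hc hcl']
        refine ⟨-1 - 2 * μ, fun x => ?_⟩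
        rw [hN]
        simp only [Set.mem_ofPred_eq]
        rw [hS.sy, show -1 - 2 * μ - x + μ = -1 - (x + μ) by ring]
      · rw [hgens A hA hcA]; exact hR
  rw [himg, Set.ncard_image_of_injOn, Set.ncard_coe_finset]
  intro A hA B hB hAB
  simp only [Finset.mem_coe, Finset.mem_filter, Finset.mem_powersetCard] at hA hB
  obtain ⟨⟨hA1, hA2⟩, _⟩ := hA
  obtain ⟨⟨hB1, hB2⟩, _⟩ := hB
  exact inj_A hal' hbe' hco hm hA1 hA2 hB1 hB2
    (NT_inj hβ hc ((good_PA hal' hbe' hco hm hA1 hA2).symT hn)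
      ((good_PA hal' hbe' hco hm hB1 hB2).symT hn) hAB)

/-- If `α` is odd and `β` is even: (i) the total number of selfdual semimodules is
`C((α-1)/2 + β/2, (α-1)/2)`; (ii) for `0 ≤ ℓ ≤ (α-1)/2` there are
`C((α-1)/2, ℓ) · C(β/2 - 1, ℓ)` selfdual semimodules with `2ℓ + 1` minimal
generators; (iii) for `1 ≤ ℓ ≤ (α-1)/2` there are
`C((α-1)/2, ℓ) · C(β/2 - 1, ℓ - 1)` selfdual semimodules with `2ℓ` minimal
generators. -/
theorem count_selfdual_odd_even (α β : ℕ)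
    (hα : 2 ≤ α) (hαβ : α < β) (hcop : Nat.Coprime α β)
    (hαodd : Odd α) (hβeven : Even β) :
    ({Δ : Set ℤ | IsNormalizedSemimodule α β Δ ∧ IsSelfdual α β Δ}.ncard =
        Nat.choose ((α - 1) / 2 + β / 2) ((α - 1) / 2)) ∧
    (∀ ℓ : ℕ, ℓ ≤ (α - 1) / 2 →
      {Δ : Set ℤ | IsNormalizedSemimodule α β Δ ∧ IsSelfdual α β Δ ∧
          ∃ E : Finset ℤ, IsMinGenSet α β Δ E ∧ E.card = 2 * ℓ + 1}.ncard =
        Nat.choose ((α - 1) / 2) ℓ * Nat.choose (β / 2 - 1) ℓ) ∧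
    (∀ ℓ : ℕ, 1 ≤ ℓ → ℓ ≤ (α - 1) / 2 →
      {Δ : Set ℤ | IsNormalizedSemimodule α β Δ ∧ IsSelfdual α β Δ ∧
          ∃ E : Finset ℤ, IsMinGenSet α β Δ E ∧ E.card = 2 * ℓ}.ncard =
        Nat.choose ((α - 1) / 2) ℓ * Nat.choose (β / 2 - 1) (ℓ - 1)) := by
  obtain ⟨a, ha⟩ := hαodd
  obtain ⟨b, hb'⟩ := hβeven
  have hb : β = 2 * b := by omega
  have hbpos : 0 < b := by omega
  have e1 : (α - 1) / 2 = a := by omega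
  have e2 : β / 2 = b := by omega
  rw [e1, e2]
  have hk : ∀ k, {Δ : Set ℤ | IsNormalizedSemimodule α β Δ ∧ IsSelfdual α β Δ ∧
          ∃ E : Finset ℤ, IsMinGenSet α β Δ E ∧ E.card = k}.ncard = ff a b k := by
    intro k
    rw [← count_chg, ← main_count ha hb hbpos hcop (fun j => j = k)]
    congr 1
    ext Δ
    simp only [Set.mem_ofPred_eq]
    constructor
    · rintro ⟨h1, h2, h3⟩
      exact ⟨h1, h2, (minGen_iff (by omega) (by omega) hcop h1 k).1 h3⟩
    · rintro ⟨h1, h2, h3⟩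
      exact ⟨h1, h2, (minGen_iff (by omega) (by omega) hcop h1 k).2 h3⟩
  obtain ⟨b, rfl⟩ : ∃ c, b = c + 1 := ⟨b - 1, by omega⟩
  refine ⟨?_, ?_, ?_⟩
  · have := main_count ha hb hbpos hcop (fun _ => True)
    simp only [and_true, Finset.filter_true, Finset.card_powersetCard, Finset.card_range] at this
    rw [this]
    exact (Nat.choose_symm_add).symm
  · intro l _
    rw [hk]
    simp only [ff]
    rw [show (2 * l + 1) / 2 = l by omega, show 2 * l / 2 = l by omega]
    simp
  · intro l hl _
    rw [hk]
    obtain ⟨l, rfl⟩ : ∃ c, l = c + 1 := ⟨l - 1, by omega⟩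
    rw [show 2 * (l + 1) = (2 * l + 1) + 1 by ring]
    simp only [ff]
    rw [show (2 * l + 1 + 1) / 2 = l + 1 by omega, show (2 * l + 1) / 2 = l by omega]
    simp
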